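/- Let A be a unital C*-algebra, let α be a flow on A, and let σ be a *-automorphism of A such that σ ∘ α_t = α_t ∘ σ for all t ∈ ℝ. Then the following are equivalent: (1) there is a sequence (u_n) of unitaries of A with each u_n in the domain D(δ_α) of the generator of α, such that ‖u_n x u_n* − σ(x)‖ → 0 for every x ∈ A and ‖δ_α(u_n)‖ → 0; (2) there is a sequence (u_n) of unitaries of A such that ‖u_n x u_n* − σ(x)‖ → 0 for every x ∈ A and ‖α_t(u_n) − u_n‖ → 0 uniformly in t on every compact subset of ℝ; (3) there is a sequence (u_n) of unitaries of A such that ‖u_n x u_n* − σ(x)‖ → 0 for every x ∈ A and ‖α_t(u_n) − u_n‖ → 0 for every t ∈ ℝ. -/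

import Mathlib

open Filter Topology

/-- `HasGenDeriv α x y` : `x` is in the domain of the generator `δ_α` of the flow
`α` and `δ_α(x) = y`. -/
def HasGenDeriv {A : Type*} [NormedRing A] [StarRing A] [CStarRing A]
    [NormedAlgebra ℂ A] [CompleteSpace A] [StarModule ℂ A]
    (α : ℝ → A ≃⋆ₐ[ℂ] A) (x y : A) : Prop :=
  Tendsto (fun t : ℝ => t⁻¹ • (α t x - x)) (𝓝[≠] (0 : ℝ)) (𝓝 y)

theorem IsSelfAdjoint.exists_sqrt_near_one {A : Type*} [CStarAlgebra A] {a : A}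
    (ha : IsSelfAdjoint a) {r : ℝ} (hr : r ≤ 1) (har : ‖a - 1‖ ≤ r) :
    ∃ b : A, IsSelfAdjoint b ∧ b * b = a ∧ ‖b - 1‖ ≤ r := by
  have hr0 : 0 ≤ r := (norm_nonneg _).trans har
  have hsub : a - 1 = cfc (fun x : ℝ => x - 1) a := by
    rw [cfc_sub (R := ℝ) (fun x => x) (fun _ => 1) a, cfc_id' ℝ a, cfc_const_one ℝ a]
  have hspec : ∀ x ∈ spectrum ℝ a, |x - 1| ≤ r := fun x hx => by
    have := norm_apply_le_norm_cfc (fun x : ℝ => x - 1) a hx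
    rw [← hsub] at this
    exact this.trans har
  refine ⟨cfc Real.sqrt a, cfc_predicate Real.sqrt a, ?_, ?_⟩
  · rw [← cfc_mul Real.sqrt Real.sqrt a]
    conv_rhs => rw [← cfc_id' ℝ a]
    refine cfc_congr fun x hx => Real.mul_self_sqrt ?_
    linarith [(abs_le.1 (hspec x hx)).1]
  · have : cfc Real.sqrt a - 1 = cfc (fun x : ℝ => √x - 1) a := by
      rw [cfc_sub Real.sqrt (fun _ => 1) a, cfc_const_one ℝ a]
    rw [this]
    refine norm_cfc_le hr0 fun x hx => ?_
    have hx := hspec x hx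
    have hx0 : 0 ≤ x := by linarith [(abs_le.1 hx).1]
    have hfac : x - 1 = (√x - 1) * (√x + 1) := by
      linear_combination -(Real.mul_self_sqrt hx0)
    rw [hfac, abs_mul, abs_of_nonneg (by positivity : 0 ≤ √x + 1)] at hx
    rw [Real.norm_eq_abs]
    nlinarith [abs_nonneg (√x - 1), Real.sqrt_nonneg x]

theorem norm_le_norm_mul_add_mul_of_near_one {A : Type*} [NormedRing A] [NormedAlgebra ℝ A]
    {b c : A}
    (hb : ‖b - 1‖ ≤ 1 / 2) (hc : ‖c - 1‖ ≤ 1 / 2) (z : A) :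
    ‖z‖ ≤ ‖b * z + z * c‖ := by
  have h1 := (norm_mul_le (b - 1) z).trans (mul_le_mul_of_nonneg_right hb (norm_nonneg z))
  have h2 := (norm_mul_le z (c - 1)).trans (mul_le_mul_of_nonneg_left hc (norm_nonneg z))
  have h3 : (2 : ℝ) • z = (b * z + z * c) - ((b - 1) * z + z * (c - 1)) := by
    rw [two_smul]
    noncomm_ring
  have h4 := norm_sub_le (b * z + z * c) ((b - 1) * z + z * (c - 1))
  have h5 := norm_add_le ((b - 1) * z) (z * (c - 1))
  rw [← h3, norm_smul, Real.norm_two] at h4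
  linarith

theorem exists_mul_add_mul_eq_of_near_one {A : Type*} [NormedRing A] [NormedAlgebra ℝ A]
    [CompleteSpace A] {b : A} (hb : ‖b - 1‖ ≤ 1 / 2) (x : A) :
    ∃ y : A, b * y + y * b = x := by
  let T : A →L[ℝ] A := (-(1 / 2 : ℝ)) •
    (ContinuousLinearMap.mul ℝ A (b - 1) + (ContinuousLinearMap.mul ℝ A).flip (b - 1))
  have hT : ‖T‖ < 1 := by
    refine (ContinuousLinearMap.opNorm_le_bound T (by norm_num : (0 : ℝ) ≤ 1 / 2)
      fun z => ?_).trans_lt (by norm_num)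
    have h1 := (norm_mul_le (b - 1) z).trans
      (mul_le_mul_of_nonneg_right hb (norm_nonneg z))
    have h2 := (norm_mul_le z (b - 1)).trans
      (mul_le_mul_of_nonneg_left hb (norm_nonneg z))
    have h3 : T z = (-(1 / 2 : ℝ)) • ((b - 1) * z + z * (b - 1)) := rfl
    rw [h3, norm_smul, norm_neg, Real.norm_of_nonneg (by norm_num)]
    linarith [norm_add_le ((b - 1) * z) (z * (b - 1))]
  obtain ⟨e, he⟩ := isUnit_one_sub_of_norm_lt_one hT
  refine ⟨(1 / 2 : ℝ) • (↑e⁻¹ : A →L[ℝ] A) x, ?_⟩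
  set y := (↑e⁻¹ : A →L[ℝ] A) x with hy
  have h : (1 - T) y = x := by
    rw [← he, hy, ← mul_apply_eq_comp, Units.mul_inv, one_apply_eq_self]
  have h3 : T y = (-(1 / 2 : ℝ)) • ((b - 1) * y + y * (b - 1)) := rfl
  rw [← h, _root_.sub_apply, h3, one_apply_eq_self, mul_smul_comm,
    smul_mul_assoc, sub_mul, mul_sub, one_mul, mul_one]
  module

section Flow

variable {A : Type*} [CStarAlgebra A] {α : ℝ → A ≃⋆ₐ[ℂ] A}

theorem hasGenDeriv_iff_hasDerivAt (hα0 : ∀ x : A, α 0 x = x) {x y : A} :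
    HasGenDeriv α x y ↔ HasDerivAt (fun t => α t x) y 0 := by
  rw [hasDerivAt_iff_tendsto_slope_zero]
  simp only [zero_add, hα0]
  rfl

/-- A *-automorphism of a C*-algebra as a real-linear continuous map. -/
noncomputable def StarAlgEquiv.toRealCLM (φ : A ≃⋆ₐ[ℂ] A) : A →L[ℝ] A :=
  LinearMap.mkContinuous
    { toFun := φ
      map_add' := map_add φ
      map_smul' := fun r x => by
        rw [← Complex.coe_smul, map_smul, RingHom.id_apply, Complex.coe_smul] }
    1 fun x => by simp [StarAlgEquiv.norm_map]

theorem HasGenDeriv.hasDerivAt (hα0 : ∀ x : A, α 0 x = x)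
    (hαadd : ∀ s t : ℝ, ∀ x : A, α (s + t) x = α s (α t x)) {x y : A}
    (h : HasGenDeriv α x y) (t : ℝ) : HasDerivAt (fun t => α t x) (α t y) t := by
  have h0 := (hasGenDeriv_iff_hasDerivAt hα0).1 h
  rw [← sub_self t] at h0
  have h1 := (α t).toRealCLM.hasFDerivAt.comp_hasDerivAt t (h0.comp_sub_const t t)
  refine h1.congr_of_eventuallyEq (.of_forall fun s => ?_)
  change α s x = α t (α (s - t) x)
  rw [← hαadd, add_sub_cancel]

theorem HasGenDeriv.norm_flow_sub_le (hα0 : ∀ x : A, α 0 x = x)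
    (hαadd : ∀ s t : ℝ, ∀ x : A, α (s + t) x = α s (α t x)) {x y : A}
    (h : HasGenDeriv α x y) (t : ℝ) : ‖α t x - x‖ ≤ ‖y‖ * |t| := by
  have := Convex.norm_image_sub_le_of_norm_hasDerivWithin_le (C := ‖y‖) (s := Set.univ)
    (fun s _ => (h.hasDerivAt hα0 hαadd s).hasDerivWithinAt)
    (fun s _ => (StarAlgEquiv.norm_map (α s) y).le) convex_univ (Set.mem_univ 0) (Set.mem_univ t)
  simpa [hα0] using this

theorem hasGenDeriv_intervalIntegral (hα0 : ∀ x : A, α 0 x = x)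
    (hαadd : ∀ s t : ℝ, ∀ x : A, α (s + t) x = α s (α t x))
    (hαcont : ∀ x : A, Continuous fun t : ℝ => α t x) (x : A) :
    HasGenDeriv α (∫ t in (0 : ℝ)..1, α t x) (α 1 x - x) := by
  rw [hasGenDeriv_iff_hasDerivAt hα0]
  have hint : ∀ a b, IntervalIntegrable (fun t => α t x) MeasureTheory.volume a b :=
    fun a b => (hαcont x).intervalIntegrable a b
  have hprim : ∀ b, HasDerivAt (fun s => ∫ t in (0 : ℝ)..s, α t x) (α b x) b := fun b =>
    intervalIntegral.integral_hasDerivAt_right (hint 0 b)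
      ((hαcont x).stronglyMeasurableAtFilter _ _) (hαcont x).continuousAt
  have h1 : HasDerivAt (fun s : ℝ => ∫ t in (0 : ℝ)..(s + 1), α t x) (α 1 x) 0 :=
    by
    simpa only [zero_add] using HasDerivAt.comp_add_const (0 : ℝ) 1 (hprim (0 + 1))
  have h2 := h1.sub (hprim 0)
  rw [hα0] at h2
  refine h2.congr_of_eventuallyEq (.of_forall fun s => ?_)
  change (α s).toRealCLM (∫ t in (0 : ℝ)..1, α t x) =
    (∫ t in (0 : ℝ)..(s + 1), α t x) - ∫ t in (0 : ℝ)..s, α t x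
  rw [← ContinuousLinearMap.intervalIntegral_comp_comm _ (hint 0 1),
    intervalIntegral.integral_interval_sub_left (hint _ _) (hint _ _)]
  change (∫ t in (0 : ℝ)..1, α s (α t x)) = _
  simp_rw [← hαadd]
  rw [intervalIntegral.integral_comp_add_left (fun t => α t x), add_zero]

theorem norm_intervalIntegral_flow_sub_le
    (hαcont : ∀ x : A, Continuous fun t : ℝ => α t x) (x : A) :
    ‖(∫ t in (0 : ℝ)..1, α t x) - x‖ ≤ ∫ t in (0 : ℝ)..1, ‖α t x - x‖ := by
  have h : (∫ t in (0 : ℝ)..1, α t x) - x = ∫ t in (0 : ℝ)..1, (α t x - x) := by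
    rw [intervalIntegral.integral_sub ((hαcont x).intervalIntegrable 0 1)
      intervalIntegrable_const]
    simp
  rw [h]
  exact intervalIntegral.norm_integral_le_integral_norm zero_le_one

theorem tendsto_intervalIntegral_norm_flow_sub
    (hαcont : ∀ x : A, Continuous fun t : ℝ => α t x) {u : ℕ → A} {C : ℝ}
    (hu : ∀ n, ‖u n‖ ≤ C) (h : ∀ t : ℝ, Tendsto (fun n => ‖α t (u n) - u n‖) atTop (𝓝 0)) :
    Tendsto (fun n => ∫ t in (0 : ℝ)..1, ‖α t (u n) - u n‖) atTop (𝓝 0) := by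
  have := intervalIntegral.tendsto_integral_filter_of_dominated_convergence
    (μ := MeasureTheory.volume) (a := 0) (b := 1) (l := atTop)
    (F := fun n t => ‖α t (u n) - u n‖) (f := fun _ => 0) (fun _ => C + C)
    (.of_forall fun n => ((hαcont (u n)).sub continuous_const).norm.aestronglyMeasurable)
    (.of_forall fun n => .of_forall fun t _ => ?_) intervalIntegrable_const
    (.of_forall fun t _ => h t)
  · simpa using this
  · rw [norm_norm]
    refine (norm_sub_le _ _).trans (add_le_add ?_ (hu n))
    rw [StarAlgEquiv.norm_map]
    exact hu n

theorem HasGenDeriv.exists_of_mul_self (hα0 : ∀ x : A, α 0 x = x)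
    (hαcont : ∀ x : A, Continuous fun t : ℝ => α t x) {b y : A} (hb : ‖b - 1‖ ≤ 1 / 2)
    (h : HasGenDeriv α (b * b) y) : ∃ z : A, HasGenDeriv α b z ∧ ‖z‖ ≤ ‖y‖ := by
  obtain ⟨z, hz⟩ := exists_mul_add_mul_eq_of_near_one hb y
  refine ⟨z, ?_, hz ▸ norm_le_norm_mul_add_mul_of_near_one hb hb z⟩
  have hbt : Tendsto (fun t => (α t b - b) * z) (𝓝[≠] 0) (𝓝 0) := by
    have : Tendsto (fun t => (α t b - b) * z) (𝓝 0) (𝓝 ((α 0 b - b) * z)) :=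
      (((hαcont b).sub continuous_const).mul continuous_const).tendsto 0
    rw [hα0, sub_self, zero_mul] at this
    exact this.mono_left nhdsWithin_le_nhds
  have hlim := (Tendsto.sub h (tendsto_const_nhds (x := y))).sub hbt
  rw [sub_self, sub_zero] at hlim
  refine tendsto_sub_nhds_zero_iff.1 (squeeze_zero_norm (fun t => ?_)
    (tendsto_zero_iff_norm_tendsto_zero.1 hlim))
  have ht : ‖α t b - 1‖ ≤ 1 / 2 := by
    rwa [← map_one (α t), ← map_sub, StarAlgEquiv.norm_map]
  refine (norm_le_norm_mul_add_mul_of_near_one ht hb _).trans_eq (congrArg _ ?_)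
  rw [← hz, map_mul, mul_sub, sub_mul _ z, mul_smul_comm, smul_mul_assoc, sub_mul _ b z]
  have : α t b * α t b - b * b = α t b * (α t b - b) + (α t b - b) * b := by noncomm_ring
  rw [this, smul_add]
  abel

theorem norm_le_one_of_mem_unitary {u : A} (hu : u ∈ unitary A) : ‖u‖ ≤ 1 := by
  rcases subsingleton_or_nontrivial A with _ | _
  · simp [Subsingleton.elim u 0]
  · exact (CStarRing.norm_of_mem_unitary hu).le

theorem HasGenDeriv.exists_unitary_near (hα0 : ∀ x : A, α 0 x = x)
    (hαcont : ∀ x : A, Continuous fun t : ℝ => α t x) {u v y : A} {r : ℝ}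
    (hu : u ∈ unitary A) (hv : HasGenDeriv α v y) (hvu : ‖v - u‖ ≤ r) (hr : r ≤ 1 / 8) :
    ∃ w ∈ unitary A, ∃ z : A, HasGenDeriv α w z ∧ ‖w - u‖ ≤ 4 * r ∧ ‖z‖ ≤ 10 * ‖y‖ := by
  have hr0 : 0 ≤ r := (norm_nonneg _).trans hvu
  have hu1 := norm_le_one_of_mem_unitary hu
  have hv2 : ‖v‖ ≤ 2 := by linarith [norm_le_norm_add_norm_sub' v u]
  have hvv : ‖star v * v - 1‖ ≤ 3 * r := by
    have : star v * v - 1 = star v * (v - u) + star (v - u) * u := by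
      rw [← (Unitary.mem_iff.1 hu).1, star_sub]
      noncomm_ring
    rw [this]
    have h1 := norm_mul_le (star v) (v - u)
    have h2 := norm_mul_le (star (v - u)) u
    rw [norm_star] at h1 h2
    have h3 := norm_add_le (star v * (v - u)) (star (v - u) * u)
    nlinarith [norm_nonneg v, norm_nonneg (v - u), norm_nonneg u]
  obtain ⟨b, hbsa, hbb, hb1⟩ :=
    (IsSelfAdjoint.star_mul_self v).exists_sqrt_near_one (by linarith) hvv
  have hvd := (hasGenDeriv_iff_hasDerivAt hα0).1 hv
  have hvvd : HasGenDeriv α (b * b) (star y * v + star v * y) := by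
    rw [hbb, hasGenDeriv_iff_hasDerivAt hα0]
    have := hvd.star.mul hvd
    simp only [hα0] at this
    refine this.congr_of_eventuallyEq (.of_forall fun t => ?_)
    change α t (star v * v) = star (α t v) * α t v
    rw [map_mul, map_star]
  obtain ⟨db, hdb, hdbn⟩ := hvvd.exists_of_mul_self hα0 hαcont (by linarith)
  have hdb4 : ‖db‖ ≤ 4 * ‖y‖ := by
    have h1 := norm_mul_le (star y) v
    have h2 := norm_mul_le (star v) y
    rw [norm_star] at h1 h2
    have h3 := norm_add_le (star y * v) (star v * y)
    nlinarith [norm_nonneg v, norm_nonneg y]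
  obtain ⟨e, he⟩ : IsUnit b := by
    have : ‖1 - b‖ < 1 := by rw [norm_sub_rev]; linarith
    simpa using isUnit_one_sub_of_norm_lt_one this
  obtain ⟨f, hf⟩ : IsUnit v := by
    have h1 : ‖star u * (u - v)‖ < 1 := by
      have := norm_mul_le (star u) (u - v)
      rw [norm_star, norm_sub_rev u v] at this
      nlinarith [norm_nonneg (v - u)]
    have h2 : v = u * (1 - star u * (u - v)) := by
      rw [mul_sub, ← mul_assoc, (Unitary.mem_iff.1 hu).2]
      noncomm_ring
    rw [h2]
    exact (Unitary.toUnits ⟨u, hu⟩).isUnit.mul (isUnit_one_sub_of_norm_lt_one h1)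
  have hwb : (↑(f * e⁻¹) : A) * b = v := by rw [← he, ← hf]; simp
  have hsw : star (↑(f * e⁻¹) : A) * ↑(f * e⁻¹) = 1 := by
    have hc : star (↑e⁻¹ : A) = ↑e⁻¹ := by
      have : star e = e := Units.ext (by simpa [he] using hbsa.star_eq)
      rw [← Units.coe_star, star_inv, this]
    have : star (f : A) * f = e * e := by rw [hf, he, hbb]
    rw [Units.val_mul, star_mul, hc, mul_assoc, ← mul_assoc (star (f : A)), this]
    simp
  have hw : (↑(f * e⁻¹) : A) ∈ unitary A :=
    Unitary.mem_iff.2 ⟨hsw, by rw [← Units.inv_eq_of_mul_eq_one_left hsw, Units.mul_inv]⟩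
  have hinv : HasDerivAt (fun t => α t (↑e⁻¹ : A)) (-(↑e⁻¹ * db * ↑e⁻¹)) 0 := by
    have h1 := hasFDerivAt_ringInverse (𝕜 := ℝ) e
    rw [he, ← hα0 b] at h1
    refine (h1.comp_hasDerivAt 0
      ((hasGenDeriv_iff_hasDerivAt hα0).1 hdb)).congr_of_eventuallyEq (.of_forall fun t => ?_)
    have := Ring.inverse_unit (Units.map (α t : A →* A) e)
    rw [← map_inv] at this
    simpa [he] using this.symm
  have hwd := hvd.mul hinv
  simp only [hα0] at hwd
  set z := y * ↑e⁻¹ + v * -(↑e⁻¹ * db * ↑e⁻¹) with hz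
  refine ⟨_, hw, z, ?_, ?_, ?_⟩
  · rw [hasGenDeriv_iff_hasDerivAt hα0]
    refine hwd.congr_of_eventuallyEq (.of_forall fun t => ?_)
    change α t (↑(f * e⁻¹) : A) = α t v * α t (↑e⁻¹ : A)
    rw [Units.val_mul, hf, map_mul]
  · have hw1 := norm_le_one_of_mem_unitary hw
    have : (↑(f * e⁻¹) : A) - u = (v - u) - ↑(f * e⁻¹) * (b - 1) := by
      rw [mul_sub, hwb, mul_one]
      abel
    rw [this]
    have h1 := norm_sub_le (v - u) (↑(f * e⁻¹) * (b - 1))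
    have h2 := norm_mul_le (↑(f * e⁻¹) : A) (b - 1)
    nlinarith [norm_nonneg (b - 1)]
  · have hw1 := norm_le_one_of_mem_unitary hw
    have hzb : z = y - ↑(f * e⁻¹) * db - z * (b - 1) := by
      have : z * b = y - ↑(f * e⁻¹) * db := by
        rw [hz, Units.val_mul, hf, ← he]
        simp [add_mul, mul_assoc, sub_eq_add_neg]
      rw [mul_sub, this, mul_one]
      abel
    have h1 := norm_sub_le (y - ↑(f * e⁻¹) * db) (z * (b - 1))
    have h2 := norm_sub_le y (↑(f * e⁻¹) * db)
    have h3 := norm_mul_le (↑(f * e⁻¹) : A) db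
    have h4 := norm_mul_le z (b - 1)
    rw [← hzb] at h1
    nlinarith [norm_nonneg z, norm_nonneg db]

theorem norm_unitary_conj_sub_le {u w : A} (hu : u ∈ unitary A) (hw : w ∈ unitary A) (x y : A) :
    ‖w * x * star w - y‖ ≤ 2 * ‖x‖ * ‖w - u‖ + ‖u * x * star u - y‖ := by
  have h : w * x * star w - y =
      ((w - u) * x * star w + u * x * star (w - u)) + (u * x * star u - y) := by
    rw [star_sub]
    noncomm_ring
  have hu1 := norm_le_one_of_mem_unitary hu
  have hw1 := norm_le_one_of_mem_unitary hw
  have h1 : ‖(w - u) * x * star w‖ ≤ ‖w - u‖ * ‖x‖ * ‖w‖ := by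
    simpa using norm_mul₃_le (a := w - u) (b := x) (c := star w)
  have h2 : ‖u * x * star (w - u)‖ ≤ ‖u‖ * ‖x‖ * ‖w - u‖ := by
    rw [← norm_star (w - u)]
    exact norm_mul₃_le
  have hp : 0 ≤ ‖w - u‖ * ‖x‖ := by positivity
  rw [h]
  refine (norm_add_le _ _).trans (add_le_add ((norm_add_le _ _).trans ?_) le_rfl)
  nlinarith

theorem exists_hasGenDeriv_of_tendsto (hα0 : ∀ x : A, α 0 x = x)
    (hαadd : ∀ s t : ℝ, ∀ x : A, α (s + t) x = α s (α t x))
    (hαcont : ∀ x : A, Continuous fun t : ℝ => α t x) {φ : A → A} {u : ℕ → A}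
    (hu : ∀ n, u n ∈ unitary A)
    (hφ : ∀ x : A, Tendsto (fun n => ‖u n * x * star (u n) - φ x‖) atTop (𝓝 0))
    (h : ∀ t : ℝ, Tendsto (fun n => ‖α t (u n) - u n‖) atTop (𝓝 0)) :
    ∃ (w : ℕ → A) (d : ℕ → A), (∀ n, w n ∈ unitary A) ∧ (∀ n, HasGenDeriv α (w n) (d n)) ∧
      (∀ x : A, Tendsto (fun n => ‖w n * x * star (w n) - φ x‖) atTop (𝓝 0)) ∧
      Tendsto (fun n => ‖d n‖) atTop (𝓝 0) := by
  have hr := tendsto_intervalIntegral_norm_flow_sub hαcont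
    (fun n => norm_le_one_of_mem_unitary (hu n)) h
  set r : ℕ → ℝ := fun n => ∫ t in (0 : ℝ)..1, ‖α t (u n) - u n‖
  obtain ⟨N, hN⟩ := eventually_atTop.1 (hr.eventually (eventually_le_nhds (b := 1 / 8)
    (by norm_num)))
  have key : ∀ n, ∃ w ∈ unitary A, ∃ z : A, HasGenDeriv α w z ∧
      ‖w - u (n + N)‖ ≤ 4 * r (n + N) ∧ ‖z‖ ≤ 10 * ‖α 1 (u (n + N)) - u (n + N)‖ := fun n =>
    (hasGenDeriv_intervalIntegral hα0 hαadd hαcont (u (n + N))).exists_unitary_near hα0 hαcont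
      (hu _) (norm_intervalIntegral_flow_sub_le hαcont _) (hN _ (Nat.le_add_left N n))
  choose w hw d hd hwu hdn using key
  have hshift := tendsto_add_atTop_nat N
  refine ⟨w, d, hw, hd, fun x => ?_, ?_⟩
  · refine squeeze_zero (fun _ => norm_nonneg _) (fun n =>
      (norm_unitary_conj_sub_le (hu (n + N)) (hw n) x (φ x)).trans
        (add_le_add (mul_le_mul_of_nonneg_left (hwu n) (by positivity)) le_rfl)) ?_
    simpa using! (((hr.comp hshift).const_mul 4).const_mul (2 * ‖x‖)).add ((hφ x).comp hshift)
  · refine squeeze_zero (fun _ => norm_nonneg _) hdn ?_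
    simpa using! ((h 1).comp hshift).const_mul 10

theorem exists_forall_compact_norm_flow_sub_lt (hα0 : ∀ x : A, α 0 x = x)
    (hαadd : ∀ s t : ℝ, ∀ x : A, α (s + t) x = α s (α t x)) {u d : ℕ → A}
    (hd : ∀ n, HasGenDeriv α (u n) (d n)) (h : Tendsto (fun n => ‖d n‖) atTop (𝓝 0))
    {K : Set ℝ} (hK : IsCompact K) {ε : ℝ} (hε : 0 < ε) :
    ∃ N : ℕ, ∀ n ≥ N, ∀ t ∈ K, ‖α t (u n) - u n‖ < ε := by
  obtain ⟨C, hC⟩ := hK.isBounded.exists_norm_le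
  have hlim : Tendsto (fun n => ‖d n‖ * C) atTop (𝓝 0) := by simpa using h.mul_const C
  obtain ⟨N, hN⟩ := eventually_atTop.1 (hlim.eventually (gt_mem_nhds hε))
  refine ⟨N, fun n hn t ht => ((hd n).norm_flow_sub_le hα0 hαadd t).trans_lt ?_⟩
  exact (mul_le_mul_of_nonneg_left (hC t ht) (norm_nonneg _)).trans_lt (hN n hn)

end Flow

/-- For a flow `α` on a unital C*-algebra `A` and an automorphism
`σ` commuting with `α`, the three formulations of "`σ` is `α`-invariantly
approximately inner" are equivalent. -/
theorem invariantly_approximately_inner_tfae {A : Type*} [NormedRing A] [StarRing A]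
    [CStarRing A] [NormedAlgebra ℂ A] [CompleteSpace A] [StarModule ℂ A]
    (α : ℝ → A ≃⋆ₐ[ℂ] A)
    (hα0 : ∀ x : A, α 0 x = x)
    (hαadd : ∀ s t : ℝ, ∀ x : A, α (s + t) x = α s (α t x))
    (hαcont : ∀ x : A, Continuous fun t : ℝ => α t x)
    (σ : A ≃⋆ₐ[ℂ] A)
    (hcomm : ∀ t : ℝ, ∀ x : A, σ (α t x) = α t (σ x)) :
    List.TFAE
      [ -- (1) unitaries in the generator domain with derivatives tending to 0
        ∃ (u : ℕ → A) (d : ℕ → A), (∀ n, u n ∈ unitary A) ∧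
          (∀ n, HasGenDeriv α (u n) (d n)) ∧
          (∀ x : A, Tendsto (fun n => ‖u n * x * star (u n) - σ x‖) atTop (𝓝 0)) ∧
          Tendsto (fun n => ‖d n‖) atTop (𝓝 0),
        -- (2) unitaries with `‖α_t(u_n) - u_n‖ → 0` uniformly on compacts
        ∃ u : ℕ → A, (∀ n, u n ∈ unitary A) ∧
          (∀ x : A, Tendsto (fun n => ‖u n * x * star (u n) - σ x‖) atTop (𝓝 0)) ∧
          (∀ K : Set ℝ, IsCompact K → ∀ ε : ℝ, 0 < ε → ∃ N : ℕ, ∀ n ≥ N, ∀ t ∈ K,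
            ‖α t (u n) - u n‖ < ε),
        -- (3) unitaries with `‖α_t(u_n) - u_n‖ → 0` for each `t`
        ∃ u : ℕ → A, (∀ n, u n ∈ unitary A) ∧
          (∀ x : A, Tendsto (fun n => ‖u n * x * star (u n) - σ x‖) atTop (𝓝 0)) ∧
          (∀ t : ℝ, Tendsto (fun n => ‖α t (u n) - u n‖) atTop (𝓝 0)) ] := by
  let : CStarAlgebra A := {}
  tfae_have 1 → 2 := fun ⟨u, d, hu, hd, hσ, hlim⟩ => ⟨u, hu, hσ, fun K hK ε hε =>
    exists_forall_compact_norm_flow_sub_lt hα0 hαadd hd hlim hK hε⟩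
  tfae_have 2 → 3 := fun ⟨u, hu, hσ, h⟩ => ⟨u, hu, hσ, fun t =>
    Metric.tendsto_atTop.2 fun ε hε => (h {t} isCompact_singleton ε hε).imp fun N hN n hn => by
      simpa using hN n hn t rfl⟩
  tfae_have 3 → 1 := fun ⟨_, hu, hσ, h⟩ =>
    exists_hasGenDeriv_of_tendsto hα0 hαadd hαcont hu hσ h
  tfae_finish
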